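/- Let p be a prime power, m ≥ 1 an integer, and Θ(t) ∈ F_p((t^{-1})) a quadratic irrational. Let X be a finite alphabet containing distinguished symbols 0 and A, let ζ be a two-dimensional uniform [p,p]-morphism on X (ζ sends each letter to a p×p array over X and extends to arrays by applying it entrywise and assembling the resulting blocks) such that ζ(A)[0,0] = A and ζ(0) is the all-0 array, and let ξ be an [m,m]-coding sending each letter of X to an m×m array over {0,1}, extended blockwise, with ξ(0) the all-zero array. Suppose the profile of the number wall of Θ equals ξ(ζ^∞(A)): for all m', n' ≥ 0, W(Θ)[m',n'] = 0 if and only if the (m',n') entry of ξ(ζ^∞(A)) is 0, where ζ^∞(A) = lim_{k→∞} ζ^k(A) is the two-dimensional fixed point. If lim_{k→∞} N_0(ζ^k(A))/p^{2k} = 1, where N_0(B) denotes the number of entries of the array B equal to the letter 0, then Θ exhibits full generic escape of mass with respect to {t^k}_{k≥0}: for every ε > 0, lim_{n→∞} d({k ∈ ℕ : e_{k,n}(Θ) > 1 − ε}) = 1. -/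

import Mathlib

open scoped Classical
open Filter Polynomial

noncomputable section

namespace EscapeOfMass

variable {K : Type*} [Field K]

/-- The element `t` of `K((t⁻¹))`, modelled as the Laurent series field `K⸨X⸩`
in the variable `X = t⁻¹`; thus `t = X⁻¹ = single (-1) 1`. -/
def tLS (K : Type*) [Field K] : LaurentSeries K := HahnSeries.single (-1 : ℤ) 1

/-- The polynomial part of a Laurent series in `K((t⁻¹))` (the terms with
non-negative powers of `t`, i.e. non-positive powers of `X`). -/
def polyPart (f : LaurentSeries K) : LaurentSeries K :=
  { coeff := fun n => if n ≤ 0 then f.coeff n else 0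
    isPWO_support' := by
      refine f.isPWO_support'.mono fun n hn => ?_
      simp only [Function.mem_support, ne_eq] at hn ⊢
      intro h
      exact hn (by simp [h]) }

/-- The fractional part `⟨f⟩` of a Laurent series in `K((t⁻¹))`. -/
def fracPart (f : LaurentSeries K) : LaurentSeries K := f - polyPart f

/-- The complete quotients of the continued fraction expansion of `f`. -/
def cfQuot (f : LaurentSeries K) : ℕ → LaurentSeries K
  | 0 => f
  | i + 1 => (cfQuot f i - polyPart (cfQuot f i))⁻¹

/-- The partial quotients `A_i` of the continued fraction expansion of `f`. -/
def cfPQ (f : LaurentSeries K) (i : ℕ) : LaurentSeries K := polyPart (cfQuot f i)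

/-- The degree (as an integer) of a Laurent series viewed in `K((t⁻¹))`:
for a nonzero polynomial in `t` this is the usual degree. -/
def degZ (f : LaurentSeries K) : ℤ := -f.order

/-- `f` is a rational Laurent series, i.e. lies in `K(t)`. -/
def IsRatLS (f : LaurentSeries K) : Prop := ∃ r : RatFunc K, (r : LaurentSeries K) = f

/-- `f` is a quadratic irrational: it is irrational and a root of a quadratic
polynomial with coefficients in `K[t]`. -/
def IsQuadIrr (f : LaurentSeries K) : Prop :=
  ¬ IsRatLS f ∧ ∃ a b c : Polynomial K, a ≠ 0 ∧
    Polynomial.aeval (tLS K) a * f ^ 2 + Polynomial.aeval (tLS K) b * f +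
      Polynomial.aeval (tLS K) c = 0

/-- `(m, ℓ)` is a window for the periodic part of the continued fraction of `f`:
the partial quotients are periodic with period `ℓ ≥ 1` from index `m + 1` on. -/
def PeriodWindow (f : LaurentSeries K) (m ℓ : ℕ) : Prop :=
  1 ≤ ℓ ∧ ∀ i : ℕ, m + 1 ≤ i → cfPQ f (i + ℓ) = cfPQ f i

/-- The `n`-escape of mass of the continued fraction expansion of `f`: the proportion,
within one period of the periodic part of the partial quotients of `f`, of the sum
`∑ max (deg A_i - n) 0` relative to `∑ deg A_i`. -/
def eMassOf (f : LaurentSeries K) (n : ℕ) : ℝ :=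
  if h : ∃ s : ℕ × ℕ, PeriodWindow f s.1 s.2 then
    (∑ i ∈ Finset.Ico ((Classical.choose h).1 + 1)
        ((Classical.choose h).1 + 1 + (Classical.choose h).2),
        max ((degZ (cfPQ f i) : ℝ) - n) 0) /
    (∑ i ∈ Finset.Ico ((Classical.choose h).1 + 1)
        ((Classical.choose h).1 + 1 + (Classical.choose h).2),
        (degZ (cfPQ f i) : ℝ))
  else 0

/-- The `n`-escape of mass in the `k`-th diagonal of `f` with respect to the
sequence `{g^k}`. -/
def eMassP (g f : LaurentSeries K) (k n : ℕ) : ℝ := eMassOf (g ^ k * f) n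

/-- The `n`-escape of mass in the `k`-th diagonal of `f` with respect to `{t^k}`. -/
def eMass (f : LaurentSeries K) (k n : ℕ) : ℝ := eMassP (tLS K) f k n

/-- `f` exhibits `c` escape of mass with respect to the sequence `{g^k}`. -/
def ExhibitsEscape (g f : LaurentSeries K) (c : ℝ) : Prop :=
  ∃ L : ℝ, Tendsto (fun n : ℕ => Filter.liminf (fun k : ℕ => eMassP g f k n) atTop)
    atTop (nhds L) ∧ c ≤ L

/-- `f` exhibits exactly `c` escape of mass with respect to the sequence `{g^k}`. -/
def ExhibitsExactEscape (g f : LaurentSeries K) (c : ℝ) : Prop :=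
  Tendsto (fun n : ℕ => Filter.liminf (fun k : ℕ => eMassP g f k n) atTop)
    atTop (nhds c)

/-- `f` exhibits full (`c = 1`) maximal escape of mass with respect to `{g^k}`. -/
def ExhibitsFullMaxEscape (g f : LaurentSeries K) : Prop :=
  Tendsto (fun n : ℕ => Filter.limsup (fun k : ℕ => eMassP g f k n) atTop)
    atTop (nhds 1)

/-- `A ⊆ ℕ` has natural density `c`. -/
def HasDensity (A : Set ℕ) (c : ℝ) : Prop :=
  Tendsto (fun M : ℕ => (((Finset.Icc 1 M).filter fun k => k ∈ A).card : ℝ) / M)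
    atTop (nhds c)

/-- `f` exhibits full generic escape of mass with respect to `{t^k}`. -/
def FullGenericEscape (f : LaurentSeries K) : Prop :=
  ∀ ε : ℝ, 0 < ε → ∃ dens : ℕ → ℝ,
    (∀ n : ℕ, HasDensity {k : ℕ | 1 - ε < eMass f k n} (dens n)) ∧
    Tendsto dens atTop (nhds 1)

/-- Substitution `t ↦ P(t)` on Laurent series: for `f = ∑_{i ≥ d} a_i t^{-i}` (with
`d = f.order` in the variable `X = t⁻¹`), `substLS f P = ∑_{i ≥ d} a_i P(t)^{-i}`. -/
def substLS (f : LaurentSeries K) (P : Polynomial K) : LaurentSeries K :=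
  (Polynomial.aeval (tLS K) P)⁻¹ ^ f.order *
    HahnSeries.ofPowerSeries ℤ K
      (PowerSeries.mk fun n =>
        ∑ j ∈ Finset.range (n + 1),
          f.coeff (f.order + j) * (((Polynomial.aeval (tLS K) P)⁻¹ ^ j).coeff (n : ℤ)))

/-- The `p`-Cantor sequence over `ZMod p`. -/
def cantor (p : ℕ) : ℕ → ZMod p
  | 0 => 1
  | (n + 1) =>
    if hp : 1 < p then
      if (n + 1) % p % 2 = 1 then 0
      else (((p - 1) / 2).choose (((n + 1) % p) / 2) : ZMod p) * cantor p ((n + 1) / p)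
    else 0
  decreasing_by exact Nat.div_lt_self (Nat.succ_pos _) hp

/-- `Θ̃_p = ∑_{i ≥ 0} c_i^{(p)} t^{-i}`. -/
def cantorTilde (p : ℕ) : LaurentSeries (ZMod p) :=
  HahnSeries.ofPowerSeries ℤ (ZMod p) (PowerSeries.mk fun i => cantor p i)

/-- `Θ_p = t⁻¹ ∑_{i ≥ 0} c_i^{(p)} t^{-i}`. -/
def cantorTheta (p : ℕ) : LaurentSeries (ZMod p) :=
  HahnSeries.single (1 : ℤ) 1 * cantorTilde p

/-- The Thue–Morse sequence over `ZMod 2`. -/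
def thueMorse (n : ℕ) : ZMod 2 := ((Nat.digits 2 n).sum : ZMod 2)

/-- The Thue–Morse Laurent series `τ = ∑_{n ≥ 1} τ_n t^{-n}`. -/
def tmSeries : LaurentSeries (ZMod 2) :=
  HahnSeries.ofPowerSeries ℤ (ZMod 2) (PowerSeries.mk fun n => thueMorse n)

/-- The extension of a one-sided sequence to `ℤ` by zero. -/
def extendSeq (S : ℕ → K) : ℤ → K := fun i => if 0 ≤ i then S i.toNat else 0

/-- The entry `W(S)[m, n]` of the number wall of the (doubly infinite) sequence `s`:
the determinant of the `(m+1) × (m+1)` Toeplitz matrix `(s_{n - i + j})`. -/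
def wallEntry (s : ℤ → K) (m : ℕ) (n : ℤ) : K :=
  (Matrix.of fun i j : Fin (m + 1) => s (n - (i : ℕ) + (j : ℕ))).det

/-- The Laurent series `t⁻¹ ∑_{i ≥ 0} s_i t^{-i}` associated to a sequence. -/
def seriesOf (S : ℕ → K) : LaurentSeries K :=
  HahnSeries.single (1 : ℤ) 1 * HahnSeries.ofPowerSeries ℤ K (PowerSeries.mk S)

/-- The coefficient sequence of `Θ = t⁻¹ ∑ s_i t^{-i}`, extended to `ℤ` by zero. -/
def coeffSeq (f : LaurentSeries K) : ℤ → K := fun i => if 0 ≤ i then f.coeff (i + 1) else 0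

/-- The absolute value of a Laurent series in `F_q((t⁻¹))`: `|f| = q^{deg f}`. -/
def absLS {K : Type*} [Field K] [Fintype K] (f : LaurentSeries K) : ℝ :=
  if f = 0 then 0 else (Fintype.card K : ℝ) ^ (-f.order)


/-- Iteration of a two-dimensional uniform `[p,p]`-morphism `ζ` on an alphabet `X`:
`morphIter p ζ k x i j` is the `(i, j)` entry of the `p^k × p^k` array `ζ^k(x)`. -/
def morphIter {X : Type*} (p : ℕ) (ζ : X → ℕ → ℕ → X) : ℕ → X → ℕ → ℕ → X
  | 0, x, _, _ => x
  | k + 1, x, i, j => ζ (morphIter p ζ k x (i / p) (j / p)) (i % p) (j % p)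

/-- The two-dimensional fixed point `ζ^∞(x)` of a `[p,p]`-morphism prolongable at `x`. -/
def morphInf {X : Type*} (p : ℕ) (ζ : X → ℕ → ℕ → X) (x : X) (i j : ℕ) : X :=
  morphIter p ζ (i + j + 1) x i j

def IsPoly (f : LaurentSeries K) : Prop := ∀ n : ℤ, 0 < n → f.coeff n = 0

def Ge (f : LaurentSeries K) (N : ℤ) : Prop := ∀ n : ℤ, n < N → f.coeff n = 0

lemma Ge.mono {f : LaurentSeries K} {N M : ℤ} (h : Ge f N) (hm : M ≤ N) : Ge f M :=
  fun n hn => h n (by omega)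

lemma Ge.add {f g : LaurentSeries K} {N : ℤ} (h : Ge f N) (h' : Ge g N) : Ge (f + g) N :=
  fun n hn => by rw [HahnSeries.coeff_add, h n hn, h' n hn, add_zero]

lemma Ge.neg {f : LaurentSeries K} {N : ℤ} (h : Ge f N) : Ge (-f) N :=
  fun n hn => by rw [HahnSeries.coeff_neg, h n hn, neg_zero]

lemma Ge.sub {f g : LaurentSeries K} {N : ℤ} (h : Ge f N) (h' : Ge g N) : Ge (f - g) N :=
  fun n hn => by rw [HahnSeries.coeff_sub, h n hn, h' n hn, sub_zero]

lemma Ge.mul {f g : LaurentSeries K} {N M : ℤ} (h : Ge f N) (h' : Ge g M) : Ge (f * g) (N + M) := by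
  intro n hn
  by_contra hne
  obtain ⟨i, hi, j, hj, hij⟩ := HahnSeries.support_mul_subset (x := f) (y := g) hne
  have h1 : N ≤ i := by
    by_contra hc; exact hi (h i (by omega))
  have h2 : M ≤ j := by
    by_contra hc; exact hj (h' j (by omega))
  simp only at hij
  omega

lemma IsPoly.mul {f g : LaurentSeries K} (h : IsPoly f) (h' : IsPoly g) : IsPoly (f * g) := by
  intro n hn
  by_contra hne
  obtain ⟨i, hi, j, hj, hij⟩ := HahnSeries.support_mul_subset (x := f) (y := g) hne
  have h1 : i ≤ 0 := by
    by_contra hc; exact hi (h i (by omega))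
  have h2 : j ≤ 0 := by
    by_contra hc; exact hj (h' j (by omega))
  simp only at hij
  omega

lemma IsPoly.add {f g : LaurentSeries K} (h : IsPoly f) (h' : IsPoly g) : IsPoly (f + g) :=
  fun n hn => by rw [HahnSeries.coeff_add, h n hn, h' n hn, add_zero]

lemma IsPoly.sub {f g : LaurentSeries K} (h : IsPoly f) (h' : IsPoly g) : IsPoly (f - g) :=
  fun n hn => by rw [HahnSeries.coeff_sub, h n hn, h' n hn, sub_zero]

lemma isPoly_single {n : ℤ} (hn : n ≤ 0) (c : K) :
    IsPoly (HahnSeries.single n c : LaurentSeries K) := by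
  intro k hk
  exact HahnSeries.coeff_single_of_ne (by omega)

lemma isPoly_one : IsPoly (1 : LaurentSeries K) := isPoly_single le_rfl 1

lemma isPoly_tpow (k : ℕ) : IsPoly (tLS K ^ k) := by
  induction k with
  | zero => simpa using isPoly_one
  | succ k ih => rw [pow_succ]; exact ih.mul (isPoly_single (by norm_num) 1)

lemma isPoly_aeval (P : Polynomial K) : IsPoly (Polynomial.aeval (tLS K) P) := by
  induction P using Polynomial.induction_on' with
  | add p q hp hq => rw [map_add]; exact hp.add hq
  | monomial n c =>
    rw [Polynomial.aeval_monomial]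
    refine IsPoly.mul ?_ (isPoly_tpow n)
    rw [LaurentSeries.algebraMap_apply]
    exact isPoly_single le_rfl c

lemma isPoly_polyPart (f : LaurentSeries K) : IsPoly (polyPart f) := by
  intro n hn
  show (if n ≤ 0 then f.coeff n else 0) = 0
  rw [if_neg (by omega)]

lemma ge_frac (f : LaurentSeries K) : Ge (f - polyPart f) 1 := by
  intro n hn
  rw [HahnSeries.coeff_sub]
  show f.coeff n - (if n ≤ 0 then f.coeff n else 0) = 0
  rw [if_pos (by omega), sub_self]

lemma ge_order (f : LaurentSeries K) : Ge f f.order :=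
  fun _ hn => HahnSeries.coeff_eq_zero_of_lt_order hn

lemma le_order_of_ge {f : LaurentSeries K} {N : ℤ} (hf : f ≠ 0) (h : Ge f N) : N ≤ f.order := by
  by_contra hc
  exact HahnSeries.coeff_order_eq_zero.not.mpr hf (h _ (by omega))

lemma poly_zero {f : LaurentSeries K} (h : IsPoly f) (h' : Ge f 1) : f = 0 := by
  ext n
  by_cases hn : 0 < n
  · exact h n hn
  · exact h' n (by omega)

lemma order_inv' {f : LaurentSeries K} (hf : f ≠ 0) : (f⁻¹).order = - f.order := by
  have h := HahnSeries.order_mul hf (inv_ne_zero hf)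
  rw [mul_inv_cancel₀ hf, HahnSeries.order_one] at h
  omega

lemma order_polyPart {f : LaurentSeries K} (hf : f ≠ 0) (h : f.order ≤ 0) :
    (polyPart f).order = f.order := by
  have hc : (polyPart f).coeff f.order ≠ 0 := by
    show (if f.order ≤ 0 then f.coeff f.order else 0) ≠ 0
    rw [if_pos h]
    exact HahnSeries.coeff_order_eq_zero.not.mpr hf
  have hne : polyPart f ≠ 0 := by
    rintro h0; rw [h0] at hc; simp at hc
  apply le_antisymm
  · exact HahnSeries.order_le_of_coeff_ne_zero hc
  · apply le_order_of_ge hne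
    intro n hn
    show (if n ≤ 0 then f.coeff n else 0) = 0
    split_ifs
    · exact HahnSeries.coeff_eq_zero_of_lt_order hn
    · rfl

/-- non terminating continued fraction -/
def NT (f : LaurentSeries K) : Prop := ∀ i, cfQuot f i - polyPart (cfQuot f i) ≠ 0

lemma cfQuot_add (f : LaurentSeries K) (i j : ℕ) : cfQuot f (i + j) = cfQuot (cfQuot f i) j := by
  induction j with
  | zero => rfl
  | succ j ih => rw [← add_assoc, cfQuot, cfQuot, ih]

lemma NT.shift {f : LaurentSeries K} (h : NT f) (i : ℕ) : NT (cfQuot f i) := by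
  intro j
  rw [← cfQuot_add]
  exact h _

lemma NT.order_le {f : LaurentSeries K} (h : NT f) (i : ℕ) : (cfQuot f (i + 1)).order ≤ -1 := by
  rw [cfQuot, order_inv' (h i)]
  have := le_order_of_ge (h i) (ge_frac _)
  omega

lemma NT.ne_zero {f : LaurentSeries K} (h : NT f) (i : ℕ) : cfQuot f (i + 1) ≠ 0 := by
  rw [cfQuot]
  exact inv_ne_zero (h i)

lemma NT.deg_eq {f : LaurentSeries K} (h : NT f) (i : ℕ) :
    degZ (cfPQ f (i + 1)) = - (cfQuot f (i + 1)).order := by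
  rw [degZ, cfPQ, order_polyPart (h.ne_zero i) (by have := h.order_le i; omega)]

lemma NT.deg_pos {f : LaurentSeries K} (h : NT f) (i : ℕ) : 1 ≤ degZ (cfPQ f (i + 1)) := by
  rw [h.deg_eq]
  have := h.order_le i
  omega

lemma best_approx (i : ℕ) : ∀ (f : LaurentSeries K), NT f → ∀ Q P : LaurentSeries K,
    IsPoly Q → IsPoly P →
    Ge Q (1 - ∑ j ∈ Finset.range i, degZ (cfPQ f (j + 1))) →
    Ge (Q * f - P) (1 + ∑ j ∈ Finset.range i, degZ (cfPQ f (j + 1))) → Q = 0 ∧ P = 0 := by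
  induction i with
  | zero =>
    intro f hf Q P hQ hP h1 h2
    simp only [Finset.range_zero, Finset.sum_empty, sub_zero, add_zero] at h1 h2
    have hQ0 : Q = 0 := poly_zero hQ h1
    subst hQ0
    refine ⟨rfl, poly_zero hP ?_⟩
    simpa using h2.neg
  | succ i ih =>
    intro f hf Q P hQ hP h1 h2
    set θ := cfQuot f 1 with hθ
    have hθ0 : θ ≠ 0 := hf.ne_zero 0
    have hfr : f - polyPart f = θ⁻¹ := by
      rw [hθ]; simp [cfQuot]
    have hsum : ∑ j ∈ Finset.range (i + 1), degZ (cfPQ f (j + 1)) =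
        ∑ j ∈ Finset.range i, degZ (cfPQ θ (j + 1)) - θ.order := by
      rw [Finset.sum_range_succ', hf.deg_eq 0, sub_eq_add_neg]
      congr 1
      apply Finset.sum_congr rfl
      intro j _
      rw [cfPQ, cfPQ, hθ, ← cfQuot_add]
      congr 3
      omega
    have hd : 0 ≤ ∑ j ∈ Finset.range i, degZ (cfPQ θ (j + 1)) := by
      apply Finset.sum_nonneg
      intro j _
      have := (hf.shift 1).deg_pos j
      rw [← hθ] at this
      omega
    rw [hsum] at h1 h2
    set d := ∑ j ∈ Finset.range i, degZ (cfPQ θ (j + 1)) with hdd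
    have ho : θ.order ≤ -1 := hf.order_le 0
    have hinv : Ge θ⁻¹ (-θ.order) := by
      have := ge_order θ⁻¹
      rwa [order_inv' hθ0] at this
    have hR : P - Q * polyPart f = Q * θ⁻¹ - (Q * f - P) := by
      rw [← hfr]; ring
    have hRθ : (P - Q * polyPart f) * θ - Q = - (θ * (Q * f - P)) := by
      rw [hR]; field_simp; ring
    have key := ih θ (hf.shift 1) (P - Q * polyPart f) Q
      (hP.sub (hQ.mul (isPoly_polyPart f))) hQ
      (by
        rw [hR]
        exact ((h1.mul hinv).mono (by omega)).sub (h2.mono (by omega)))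
      (by
        rw [hRθ]
        exact (((ge_order θ).mul h2).mono (by omega)).neg)
    obtain ⟨k1, k2⟩ := key
    refine ⟨k2, ?_⟩
    rw [k2] at k1
    simpa using k1

lemma finite_polys [Finite K] (M : ℤ) :
    {f : LaurentSeries K | IsPoly f ∧ Ge f M}.Finite := by
  apply Set.Finite.of_injOn (f := fun f : LaurentSeries K => fun n : Finset.Icc M 0 => f.coeff n)
    (t := Set.univ) (fun _ _ => Set.mem_univ _) _ Set.finite_univ
  intro f hf g hg hfg
  ext n
  by_cases h1 : 0 < n
  · rw [hf.1 n h1, hg.1 n h1]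
  by_cases h2 : n < M
  · rw [hf.2 n h2, hg.2 n h2]
  · exact congrFun hfg ⟨n, Finset.mem_Icc.mpr ⟨by omega, by omega⟩⟩

lemma finite_roots {F : Type*} [Field F] (a b c : F) (h : ¬ (a = 0 ∧ b = 0 ∧ c = 0)) :
    {x : F | a * x ^ 2 + b * x + c = 0}.Finite := by
  have hp : (Polynomial.C a * Polynomial.X ^ 2 + Polynomial.C b * Polynomial.X +
      Polynomial.C c : Polynomial F) ≠ 0 := by
    intro h0
    apply h
    have h2 := congrArg (fun q => q.coeff 2) h0
    have h1 := congrArg (fun q => q.coeff 1) h0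
    have h00 := congrArg (fun q => q.coeff 0) h0
    simp [Polynomial.coeff_X, Polynomial.coeff_C] at h2 h1 h00
    exact ⟨h2, h1, h00⟩
  refine (Polynomial.finite_setOfPred_isRoot hp).subset ?_
  intro x hx
  simpa [Polynomial.IsRoot] using hx

lemma quad_inv {f a b c : LaurentSeries K} (hf : NT f) (M : ℤ)
    (ha : IsPoly a) (hb : IsPoly b) (hc : IsPoly c)
    (h0 : ¬ (a = 0 ∧ b = 0 ∧ c = 0)) (h : a * f ^ 2 + b * f + c = 0)
    (hMa : Ge a M) (hMb : Ge b M) (hMc : Ge c M) (hMD : Ge (2 * a * f + b) M) (n : ℕ) :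
    ∃ a b c : LaurentSeries K, (IsPoly a ∧ Ge a M) ∧ (IsPoly b ∧ Ge b M) ∧ (IsPoly c ∧ Ge c M) ∧
      Ge (2 * a * cfQuot f n + b) M ∧ ¬ (a = 0 ∧ b = 0 ∧ c = 0) ∧
      a * (cfQuot f n) ^ 2 + b * cfQuot f n + c = 0 := by
  induction n with
  | zero => exact ⟨a, b, c, ⟨ha, hMa⟩, ⟨hb, hMb⟩, ⟨hc, hMc⟩, hMD, h0, h⟩
  | succ n ih =>
    obtain ⟨a, b, c, ⟨ha, hMa⟩, ⟨hb, hMb⟩, ⟨hc, hMc⟩, hMD, h0, h⟩ := ih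
    set θ := cfQuot f n with hθ
    set A := polyPart θ with hA
    have hAp : IsPoly A := isPoly_polyPart _
    set δ := θ - A with hδ
    have hδ1 : Ge δ 1 := ge_frac θ
    have hδ0 : δ ≠ 0 := hf n
    have hθ' : cfQuot f (n + 1) = δ⁻¹ := rfl
    have hAeq : A = θ - δ := by rw [hδ]; ring
    have ea : a * A * A + b * A + c = a * δ * δ - δ * (2 * a * θ + b) := by
      rw [hAeq]; linear_combination h
    have eb : a * A + a * A + b = (2 * a * θ + b) - (a * δ + a * δ) := by
      rw [hAeq]; ring
    refine ⟨a * A * A + b * A + c, a * A + a * A + b, a, ⟨?_, ?_⟩, ⟨?_, ?_⟩, ⟨ha, hMa⟩, ?_, ?_, ?_⟩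
    · exact (((ha.mul hAp).mul hAp).add (hb.mul hAp)).add hc
    · rw [ea]
      exact (((hMa.mul hδ1).mul hδ1).mono (by omega)).sub ((hδ1.mul hMD).mono (by omega))
    · exact ((ha.mul hAp).add (ha.mul hAp)).add hb
    · rw [eb]
      exact hMD.sub (((hMa.mul hδ1).add (hMa.mul hδ1)).mono (by omega))
    · have : 2 * (a * A * A + b * A + c) * cfQuot f (n + 1) + (a * A + a * A + b)
          = - (2 * a * θ + b) := by
        rw [ea, eb, hθ']
        field_simp
        ring
      rw [this]
      exact hMD.neg
    · rintro ⟨h1, h2, h3⟩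
      apply h0
      rw [h3] at h1 h2
      simp at h1 h2
      rw [h2] at h1
      simp at h1
      exact ⟨h3, h2, h1⟩
    · rw [ea, eb, hθ']
      field_simp
      ring

lemma exists_window [Finite K] {f a b c : LaurentSeries K} (hf : NT f)
    (ha : IsPoly a) (hb : IsPoly b) (hc : IsPoly c)
    (h0 : ¬ (a = 0 ∧ b = 0 ∧ c = 0)) (h : a * f ^ 2 + b * f + c = 0) :
    ∃ s : ℕ × ℕ, PeriodWindow f s.1 s.2 := by
  obtain ⟨M, h1, h2, h3, h4⟩ : ∃ M : ℤ, M ≤ a.order ∧ M ≤ b.order ∧ M ≤ c.order ∧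
      M ≤ (2 * a * f + b).order :=
    ⟨min (min a.order b.order) (min c.order (2 * a * f + b).order), by simp, by simp, by simp,
      by simp⟩
  have hall := quad_inv hf M ha hb hc h0 h ((ge_order _).mono h1) ((ge_order _).mono h2)
    ((ge_order _).mono h3) ((ge_order _).mono h4)
  set S := {f : LaurentSeries K | IsPoly f ∧ Ge f M} with hS
  have hSf : S.Finite := finite_polys M
  set T : Set (LaurentSeries K) := ⋃ q ∈ S ×ˢ (S ×ˢ S),
    {x | ¬ (q.1 = 0 ∧ q.2.1 = 0 ∧ q.2.2 = 0) ∧ q.1 * x ^ 2 + q.2.1 * x + q.2.2 = 0} with hT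
  have hTf : T.Finite := by
    refine (hSf.prod (hSf.prod hSf)).biUnion ?_
    rintro ⟨a, b, c⟩ _
    by_cases hz : a = 0 ∧ b = 0 ∧ c = 0
    · simp [hz]
    · exact (finite_roots a b c hz).subset (fun x hx => hx.2)
  have hmem : ∀ n, cfQuot f n ∈ T := by
    intro n
    obtain ⟨a, b, c, ha, hb, hc, _, h0, h⟩ := hall n
    rw [hT]
    simp only [Set.mem_iUnion]
    exact ⟨(a, b, c), ⟨ha, hb, hc⟩, h0, h⟩
  obtain ⟨i, j, hij, he⟩ := hTf.exists_lt_map_eq_of_forall_mem hmem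
  refine ⟨(i, j - i), by show 1 ≤ j - i; omega, ?_⟩
  intro k hk
  simp only at hk ⊢
  have e1 : k + (j - i) = j + (k - i) := by omega
  have e2 : k = i + (k - i) := by omega
  rw [cfPQ, cfPQ, e1, cfQuot_add, ← he, ← cfQuot_add, ← e2]

lemma exists_hom : ∃ φ : RatFunc K →+* LaurentSeries K, (∀ r : RatFunc K, (r : LaurentSeries K) = φ r)
   ∧ φ RatFunc.X = HahnSeries.single 1 1 ∧ ∀ c, φ (RatFunc.C c) = HahnSeries.C c := by
  refine ⟨_, fun r => rfl, RatFunc.coe_X, fun c => ?_⟩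
  rw [← RatFunc.algebraMap_C, ← IsScalarTower.algebraMap_apply]
  simp

def ratF (K : Type*) [Field K] : Subfield (LaurentSeries K) :=
  (Classical.choose (exists_hom (K := K))).fieldRange

lemma isRat_iff (f : LaurentSeries K) : IsRatLS f ↔ f ∈ ratF K := by
  have h := (Classical.choose_spec (exists_hom (K := K))).1
  rw [IsRatLS, ratF, RingHom.mem_fieldRange]
  exact exists_congr fun r => by rw [h r]

lemma isRat_single (n : ℤ) (c : K) : IsRatLS (HahnSeries.single n c : LaurentSeries K) := by
  rw [isRat_iff, ratF, RingHom.mem_fieldRange]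
  obtain ⟨_, hX, hC⟩ := Classical.choose_spec (exists_hom (K := K))
  refine ⟨RatFunc.C c * RatFunc.X ^ n, ?_⟩
  rw [map_mul, map_zpow₀, hX, hC, ← RatFunc.single_zpow]
  simp [HahnSeries.C_apply, HahnSeries.single_mul_single]

lemma isRat_poly {f : LaurentSeries K} (h : IsPoly f) : IsRatLS f := by
  have : f = ∑ n ∈ Finset.Icc f.order 0, (HahnSeries.single n (f.coeff n) : LaurentSeries K) := by
    ext k
    rw [HahnSeries.coeff_sum]
    by_cases hk : k ∈ Finset.Icc f.order 0
    · rw [Finset.sum_eq_single_of_mem k hk fun b _ hb => HahnSeries.coeff_single_of_ne hb.symm,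
        HahnSeries.coeff_single_same]
    rw [Finset.sum_eq_zero fun x hx => HahnSeries.coeff_single_of_ne (by rintro rfl; exact hk hx)]
    rw [Finset.mem_Icc] at hk
    by_cases h1 : 0 < k
    · exact h k h1
    · exact ge_order f k (by omega)
  rw [this, isRat_iff]
  exact sum_mem fun n _ => (isRat_iff _).mp (isRat_single _ _)

lemma nt_of_irr {f : LaurentSeries K} (h : ¬ IsRatLS f) : NT f := by
  have key : ∀ i, ¬ IsRatLS (cfQuot f i) := by
    intro i
    induction i with
    | zero => exact h
    | succ i ih =>
      intro hr
      apply ih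
      have : cfQuot f i = polyPart (cfQuot f i) + (cfQuot f (i + 1))⁻¹ := by
        rw [cfQuot, inv_inv]; ring
      rw [this, isRat_iff]
      exact add_mem ((isRat_iff _).mp (isRat_poly (isPoly_polyPart _)))
        (inv_mem ((isRat_iff _).mp hr))
  intro i h0
  apply key i
  rw [sub_eq_zero.mp h0]
  exact isRat_poly (isPoly_polyPart _)

lemma tLS_pow (k : ℕ) : tLS K ^ k = HahnSeries.single (-(k : ℤ)) 1 := by
  rw [tLS, HahnSeries.single_pow]; simp

lemma tLS_ne_zero : tLS K ≠ 0 := by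
  rw [tLS]; simp

lemma nt_shift {f : LaurentSeries K} (h : ¬ IsRatLS f) (k : ℕ) : NT (tLS K ^ k * f) := by
  apply nt_of_irr
  intro hr
  apply h
  have : f = (tLS K ^ k)⁻¹ * (tLS K ^ k * f) := by
    rw [inv_mul_cancel_left₀ (pow_ne_zero k tLS_ne_zero)]
  rw [this, isRat_iff]
  exact mul_mem (inv_mem ((isRat_iff _).mp (isRat_poly (isPoly_tpow k)))) ((isRat_iff _).mp hr)

lemma window_shift [Finite K] {f : LaurentSeries K} (h : IsQuadIrr f) (k : ℕ) :
    ∃ s : ℕ × ℕ, PeriodWindow (tLS K ^ k * f) s.1 s.2 := by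
  obtain ⟨hirr, a, b, c, ha, he⟩ := h
  refine exists_window (nt_shift hirr k) (isPoly_aeval a)
    ((isPoly_aeval b).mul (isPoly_tpow k)) (((isPoly_aeval c).mul (isPoly_tpow k)).mul
      (isPoly_tpow k)) ?_ ?_
  · rintro ⟨h1, h2, h3⟩
    have hb : Polynomial.aeval (tLS K) b = 0 :=
      (mul_eq_zero.mp h2).resolve_right (pow_ne_zero k tLS_ne_zero)
    apply ha
    have hz : ∀ n : ℕ, (Polynomial.aeval (tLS K) a).coeff (-(n : ℤ)) = a.coeff n := by
      intro n
      rw [Polynomial.aeval_def, Polynomial.eval₂_eq_sum_range, HahnSeries.coeff_sum]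
      have hterm : ∀ x : ℕ, algebraMap K (LaurentSeries K) (a.coeff x) * tLS K ^ x =
          HahnSeries.single (-(x : ℤ)) (a.coeff x) := by
        intro x
        rw [tLS_pow, LaurentSeries.algebraMap_apply, HahnSeries.C_apply,
          HahnSeries.single_mul_single]
        simp
      simp only [hterm]
      by_cases hn : n ∈ Finset.range (a.natDegree + 1)
      · rw [Finset.sum_eq_single_of_mem n hn fun b _ hb =>
          HahnSeries.coeff_single_of_ne (by omega), HahnSeries.coeff_single_same]
      · rw [Finset.sum_eq_zero fun x hx => HahnSeries.coeff_single_of_ne (by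
          intro he; have : n = x := by omega
          subst this; exact hn hx)]
        rw [Finset.mem_range] at hn
        exact (Polynomial.coeff_eq_zero_of_natDegree_lt (by omega)).symm
    ext n
    rw [← hz n, h1]; simp
  · linear_combination (tLS K ^ k) ^ 2 * he

lemma wall_ne_zero {Θ : LaurentSeries K} (h : ¬ IsRatLS Θ) (k i m' : ℕ)
    (hm : (m' : ℤ) + 1 = ∑ j ∈ Finset.range i, degZ (cfPQ (tLS K ^ k * Θ) (j + 1))) :
    wallEntry (coeffSeq Θ) m' ((m' + k : ℕ) : ℤ) ≠ 0 := by
  intro h0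
  rw [wallEntry] at h0
  obtain ⟨v, hv, hMv⟩ := Matrix.exists_mulVec_eq_zero_iff.mpr h0
  set f := tLS K ^ k * Θ with hf
  set Q : LaurentSeries K := ∑ j : Fin (m' + 1), HahnSeries.single (-((j : ℕ) : ℤ)) (v j) with hQ
  have hQc : ∀ n : ℤ, (Q * f).coeff n = ∑ j : Fin (m' + 1), v j * Θ.coeff (n + j + k) := by
    intro n
    rw [hQ, Finset.sum_mul, HahnSeries.coeff_sum]
    apply Finset.sum_congr rfl
    intro j _
    rw [HahnSeries.coeff_single_mul, hf, tLS_pow, HahnSeries.coeff_single_mul]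
    simp
  have hQp : IsPoly Q := by
    intro n hn
    rw [hQ, HahnSeries.coeff_sum]
    exact Finset.sum_eq_zero fun j _ => isPoly_single (by omega) _ n hn
  have hQg : Ge Q (1 - ((m' : ℤ) + 1)) := by
    intro n hn
    rw [hQ, HahnSeries.coeff_sum]
    exact Finset.sum_eq_zero fun j _ => HahnSeries.coeff_single_of_ne (by omega)
  have := best_approx i f (nt_shift h k) Q (polyPart (Q * f)) hQp (isPoly_polyPart _)
    (by rw [← hm]; exact hQg)
    (by
      rw [← hm]
      intro n hn
      by_cases h1 : n < 1
      · exact ge_frac _ n h1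
      · rw [HahnSeries.coeff_sub]
        have e2 : (polyPart (Q * f)).coeff n = 0 := isPoly_polyPart _ n (by omega)
        rw [e2, sub_zero, hQc]
        obtain ⟨r, hr⟩ : ∃ r : Fin (m' + 1), n = (m' : ℤ) + 1 - (r : ℕ) :=
          ⟨⟨((m' : ℤ) + 1 - n).toNat, by omega⟩, by simp; omega⟩
        have := congrFun hMv r
        rw [Matrix.mulVec, dotProduct] at this
        rw [Pi.zero_apply] at this
        rw [← this]
        apply Finset.sum_congr rfl
        intro j _
        rw [Matrix.of_apply, coeffSeq, if_pos (by push_cast; omega), mul_comm]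
        congr 2
        push_cast
        omega)
  apply hv
  funext r
  have hc : Q.coeff (-((r : ℕ) : ℤ)) = v r := by
    rw [hQ, HahnSeries.coeff_sum, Finset.sum_eq_single r]
    · simp
    · intro b _ hb
      apply HahnSeries.coeff_single_of_ne
      intro he
      apply hb
      ext
      omega
    · simp
  rw [← hc, this.1]; simp

lemma bad_growth [Finite K] {Θ : LaurentSeries K} (hΘ : IsQuadIrr Θ) (k n : ℕ) (ε : ℝ) (hε : 0 < ε)
    (Z : ℕ → Prop)
    (hZ : ∀ m' : ℕ, wallEntry (coeffSeq Θ) m' ((m' + k : ℕ) : ℤ) ≠ 0 → Z m')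
    (hbad : eMass Θ k n ≤ 1 - ε) :
    ∃ N0 : ℕ, ∀ N ≥ N0, ε / (2 * (n + 1)) * N ≤ (((Finset.range N).filter Z).card : ℝ) := by
  have hw := window_shift hΘ k
  have hnt : NT (tLS K ^ k * Θ) := nt_shift hΘ.1 k
  have hwall : ∀ i m' : ℕ, (m' : ℤ) + 1 =
      ∑ j ∈ Finset.range i, degZ (cfPQ (tLS K ^ k * Θ) (j + 1)) → Z m' :=
    fun i m' h => hZ m' (wall_ne_zero hΘ.1 k i m' h)
  rw [eMass, eMassP] at hbad
  generalize tLS K ^ k * Θ = f at *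
  rw [eMassOf, dif_pos hw] at hbad
  have hspec := Classical.choose_spec hw
  generalize Classical.choose hw = s at *
  obtain ⟨w, l⟩ := s
  obtain ⟨hl, hper⟩ := hspec
  simp only at hl hper hbad
  obtain ⟨e, he⟩ : ∃ e : ℕ → ℕ, ∀ j, degZ (cfPQ f (j + 1)) = (e j : ℤ) :=
    ⟨fun j => (degZ (cfPQ f (j + 1))).toNat, fun j => by
      have := hnt.deg_pos j
      simp only; omega⟩
  have hepos : ∀ j, 1 ≤ e j := fun j => by
    have := hnt.deg_pos j
    rw [he] at this; omega
  have heper : ∀ j, w ≤ j → e (j + l) = e j := by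
    intro j hj
    have := hper (j + 1) (by omega)
    have h1 := he (j + l)
    have h2 := he j
    rw [show j + l + 1 = j + 1 + l by omega, this, h2] at h1
    exact_mod_cast h1.symm
  set D : ℕ → ℕ := fun i => ∑ j ∈ Finset.range i, e j with hD
  have hDs : ∀ i, D (i + 1) = D i + e i := fun i => Finset.sum_range_succ _ _
  have hDmono : StrictMono D := strictMono_nat_of_lt_succ fun i => by
    have := hDs i; have := hepos i; omega
  have hcount : ∀ i, i ≤ ((Finset.range (D i)).filter Z).card := by
    intro i
    have hsub : (Finset.range i).image (fun j => D (j + 1) - 1) ⊆ (Finset.range (D i)).filter Z := by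
      intro x hx
      rw [Finset.mem_image] at hx
      obtain ⟨j, hj, rfl⟩ := hx
      rw [Finset.mem_range] at hj
      have h1 : D (j + 1) ≤ D i := hDmono.monotone (by omega)
      have h2 := hDs j
      have h3 := hepos j
      rw [Finset.mem_filter, Finset.mem_range]
      refine ⟨by omega, hwall (j + 1) _ ?_⟩
      rw [Finset.sum_congr rfl fun x _ => he x, ← Nat.cast_sum]
      have : 1 ≤ D (j + 1) := by omega
      push_cast [this]
      rw [hD]; push_cast; ring
    have hc := Finset.card_le_card hsub
    rwa [Finset.card_image_of_injective, Finset.card_range] at hc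
    intro x y hxy
    have h1 := hDs x
    have h2 := hDs y
    have h3 := hepos x
    have h4 := hepos y
    simp only at hxy
    have h5 : D (x + 1) = D (y + 1) := by omega
    have := hDmono.injective h5
    omega
  set L := ∑ x ∈ Finset.range l, e (w + x) with hL
  have heper' : ∀ r x, e (w + r * l + x) = e (w + x) := by
    intro r x
    induction r with
    | zero => simp
    | succ r ih =>
      rw [← ih, ← heper (w + r * l + x) (by rw [add_assoc]; omega)]
      congr 1; ring
  have hDw : ∀ r, D (w + r * l) = D w + r * L := by
    intro r
    induction r with
    | zero => simp
    | succ r ih =>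
      have : w + (r + 1) * l = w + r * l + l := by ring
      rw [this]
      have h2 : D (w + r * l + l) = D (w + r * l) + ∑ x ∈ Finset.range l, e (w + r * l + x) :=
        Finset.sum_range_add _ _ _
      rw [h2, ih, Finset.sum_congr rfl fun x _ => heper' r x]
      ring
  have hLl : l ≤ L := by
    calc l = ∑ x ∈ Finset.range l, 1 := by simp
      _ ≤ L := Finset.sum_le_sum fun x _ => hepos _
  rw [Finset.sum_Ico_eq_sum_range, Finset.sum_Ico_eq_sum_range, Nat.add_sub_cancel_left] at hbad
  have hdeg : ∀ x, (degZ (cfPQ f (w + 1 + x)) : ℝ) = e (w + x) := by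
    intro x
    rw [show w + 1 + x = w + x + 1 by omega, he]; simp
  simp only [hdeg] at hbad
  rw [← Nat.cast_sum, ← hL] at hbad
  have hLpos : (0 : ℝ) < L := by exact_mod_cast (by omega : 0 < L)
  rw [div_le_iff₀ hLpos] at hbad
  have hlow : (L : ℝ) - n * l ≤ ∑ x ∈ Finset.range l, max ((e (w + x) : ℝ) - n) 0 := by
    have : (L : ℝ) - n * l = ∑ x ∈ Finset.range l, ((e (w + x) : ℝ) - n) := by
      rw [Finset.sum_sub_distrib, hL]; simp; ring
    rw [this]
    exact Finset.sum_le_sum fun x _ => le_max_left _ _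
  have hkey : ε * L ≤ (n + 1) * l := by
    have : (0 : ℝ) ≤ l := Nat.cast_nonneg _
    nlinarith
  refine ⟨2 * (D w + L), fun N hN => ?_⟩
  set r := (N - D w) / L with hr
  have hL0 : 0 < L := by omega
  have hr1 : r * L ≤ N - D w := Nat.div_mul_le_self _ _
  have hr2 : N - D w < r * L + L := by
    have := Nat.lt_div_mul_add (a := N - D w) hL0
    exact this
  have hc1 : r * l ≤ ((Finset.range N).filter Z).card := by
    calc r * l ≤ w + r * l := by omega
      _ ≤ _ := hcount _
      _ ≤ _ := Finset.card_le_card (Finset.filter_subset_filter _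
        (Finset.range_subset_range.mpr (by rw [hDw]; omega)))
  have hc2 : (r : ℝ) * l ≤ (((Finset.range N).filter Z).card : ℝ) := by exact_mod_cast hc1
  have hr3 : (N : ℝ) ≤ 2 * (r * L) := by
    have : N ≤ 2 * (r * L) := by omega
    exact_mod_cast this
  refine le_trans ?_ hc2
  rw [div_mul_eq_mul_div, div_le_iff₀ (by positivity)]
  have hr0 : (0 : ℝ) ≤ r := Nat.cast_nonneg _
  have := mul_le_mul_of_nonneg_left hkey hr0
  nlinarith

section comb

variable {X : Type*} {p : ℕ} {ζ : X → ℕ → ℕ → X} {a : X}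

lemma morphIter_stable (hp : 0 < p) (hζa : ζ a 0 0 = a) (k : ℕ) : ∀ i j : ℕ, i < p ^ k → j < p ^ k →
    morphIter p ζ (k + 1) a i j = morphIter p ζ k a i j := by
  induction k with
  | zero =>
    intro i j hi hj
    simp at hi hj
    subst hi hj
    simp [morphIter, hζa]
  | succ k ih =>
    intro i j hi hj
    rw [morphIter, ih]
    · rfl
    · rw [Nat.div_lt_iff_lt_mul hp, ← pow_succ]; exact hi
    · rw [Nat.div_lt_iff_lt_mul hp, ← pow_succ]; exact hj

lemma morphIter_stable' (hp : 0 < p) (hζa : ζ a 0 0 = a) (k d : ℕ) (i j : ℕ)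
    (hi : i < p ^ k) (hj : j < p ^ k) :
    morphIter p ζ (k + d) a i j = morphIter p ζ k a i j := by
  induction d with
  | zero => rfl
  | succ d ih =>
    rw [← add_assoc, morphIter_stable hp hζa, ih]
    · exact hi.trans_le (Nat.pow_le_pow_right hp (by omega))
    · exact hj.trans_le (Nat.pow_le_pow_right hp (by omega))

lemma morphInf_eq (hp : 1 < p) (hζa : ζ a 0 0 = a) (k : ℕ) (i j : ℕ)
    (hi : i < p ^ k) (hj : j < p ^ k) : morphInf p ζ a i j = morphIter p ζ k a i j := by
  have h1 : i < p ^ (i + j + 1) := lt_of_lt_of_le (by omega) (Nat.lt_pow_self hp).le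
  have h2 : j < p ^ (i + j + 1) := lt_of_lt_of_le (by omega) (Nat.lt_pow_self hp).le
  rw [morphInf, ← morphIter_stable' (by omega) hζa (i + j + 1) k i j h1 h2,
    ← morphIter_stable' (by omega) hζa k (i + j + 1) i j hi hj, add_comm]

lemma morphInf_step (hp : 1 < p) (hζa : ζ a 0 0 = a) (i j : ℕ) :
    morphInf p ζ a i j = ζ (morphInf p ζ a (i / p) (j / p)) (i % p) (j % p) := by
  have h1 : i < p ^ (i + j) * p := by
    rw [← pow_succ]
    exact lt_of_lt_of_le (by omega) (Nat.lt_pow_self hp).le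
  have h2 : j < p ^ (i + j) * p := by
    rw [← pow_succ]
    exact lt_of_lt_of_le (by omega) (Nat.lt_pow_self hp).le
  rw [morphInf_eq hp hζa (i + j) (i / p) (j / p) ((Nat.div_lt_iff_lt_mul (by omega)).mpr h1)
    ((Nat.div_lt_iff_lt_mul (by omega)).mpr h2)]
  rfl

lemma morphInf_block (hp : 1 < p) (hζa : ζ a 0 0 = a) (s : ℕ) : ∀ I J i j : ℕ,
    i < p ^ s → j < p ^ s → morphInf p ζ a (I * p ^ s + i) (J * p ^ s + j) =
      morphIter p ζ s (morphInf p ζ a I J) i j := by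
  induction s with
  | zero =>
    intro I J i j hi hj
    simp at hi hj
    subst hi hj
    simp [morphIter]
  | succ s ih =>
    intro I J i j hi hj
    have e : ∀ I i, (I * p ^ (s + 1) + i) / p = I * p ^ s + i / p := by
      intro I i
      rw [pow_succ, ← mul_assoc, add_comm, Nat.add_mul_div_right _ _ (by omega), add_comm]
    have e' : ∀ I i, (I * p ^ (s + 1) + i) % p = i % p := by
      intro I i
      rw [pow_succ, ← mul_assoc, add_comm, Nat.add_mul_mod_self_right]
    rw [morphInf_step hp hζa, e, e, e', e', ih]
    · rfl
    · rw [Nat.div_lt_iff_lt_mul (by omega), ← pow_succ]; exact hi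
    · rw [Nat.div_lt_iff_lt_mul (by omega), ← pow_succ]; exact hj

lemma block_bound [Finite X] (hp : 1 < p) (hζa : ζ a 0 0 = a) (z : X)
    (hN0 : Filter.Tendsto (fun k : ℕ =>
        (((Finset.range (p ^ k) ×ˢ Finset.range (p ^ k)).filter
            (fun q => morphIter p ζ k a q.1 q.2 = z)).card : ℝ) / (p : ℝ) ^ (2 * k))
      Filter.atTop (nhds 1)) (η : ℝ) (hη : 0 < η) :
    ∃ S : ℕ, ∀ s ≥ S, ∀ I J : ℕ,
      (((Finset.range (p ^ s) ×ˢ Finset.range (p ^ s)).filter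
        (fun q => morphInf p ζ a (I * p ^ s + q.1) (J * p ^ s + q.2) ≠ z)).card : ℝ) ≤
        η * ((p : ℝ) ^ s) ^ 2 := by
  have hp0 : (0 : ℝ) < p := by exact_mod_cast (by omega : 0 < p)
  -- common level for all letters
  obtain ⟨τ, hτ⟩ : ∃ τ : ℕ, ∀ I J : ℕ, ∃ I' J' : ℕ, I' < p ^ τ ∧ J' < p ^ τ ∧
      morphInf p ζ a I J = morphInf p ζ a I' J' := by
    have hfin : (Set.range fun q : ℕ × ℕ => morphInf p ζ a q.1 q.2).Finite := Set.toFinite _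
    have hch : ∀ x : X, ∃ q : ℕ × ℕ, (∃ q' : ℕ × ℕ, morphInf p ζ a q'.1 q'.2 = x) →
        morphInf p ζ a q.1 q.2 = x := by
      intro x
      by_cases h : ∃ q' : ℕ × ℕ, morphInf p ζ a q'.1 q'.2 = x
      · obtain ⟨q, hq⟩ := h
        exact ⟨q, fun _ => hq⟩
      · exact ⟨(0, 0), fun h' => absurd h' h⟩
    choose g hg using hch
    obtain ⟨τ, hτ⟩ := (Set.finite_range fun x => (g x).1 + (g x).2).bddAbove
    refine ⟨τ, fun I J => ?_⟩
    have hb : (g (morphInf p ζ a I J)).1 + (g (morphInf p ζ a I J)).2 ≤ τ :=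
      hτ ⟨morphInf p ζ a I J, rfl⟩
    have hlt : τ < p ^ τ := Nat.lt_pow_self hp
    exact ⟨(g (morphInf p ζ a I J)).1, (g (morphInf p ζ a I J)).2, by omega, by omega,
      (hg _ ⟨(I, J), rfl⟩).symm⟩
  set η' : ℝ := η / ((p : ℝ) ^ τ) ^ 2 with hη'
  have hη'0 : 0 < η' := by positivity
  obtain ⟨S, hS⟩ := (Metric.tendsto_atTop.mp hN0) η' hη'0
  refine ⟨S, fun s hs I J => ?_⟩
  obtain ⟨I', J', hI', hJ', he⟩ := hτ I J
  -- total bound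
  have htot : (((Finset.range (p ^ (s + τ)) ×ˢ Finset.range (p ^ (s + τ))).filter
        (fun q => morphIter p ζ (s + τ) a q.1 q.2 ≠ z)).card : ℝ) ≤
        η' * ((p : ℝ) ^ (s + τ)) ^ 2 := by
    have h1 := hS (s + τ) (by omega)
    have h2 := Finset.card_filter_add_card_filter_not
      (s := Finset.range (p ^ (s + τ)) ×ˢ Finset.range (p ^ (s + τ)))
      (fun q => morphIter p ζ (s + τ) a q.1 q.2 = z)
    rw [Finset.card_product, Finset.card_range] at h2
    have h3 := congrArg (Nat.cast : ℕ → ℝ) h2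
    push_cast at h3
    rw [Real.dist_eq] at h1
    have h4 := (abs_lt.mp h1).1
    have hpp : (0 : ℝ) < (p : ℝ) ^ (2 * (s + τ)) := by positivity
    rw [neg_lt_sub_iff_lt_add, ← sub_lt_iff_lt_add', lt_div_iff₀ hpp] at h4
    have h5 : (p : ℝ) ^ (2 * (s + τ)) = ((p : ℝ) ^ (s + τ)) ^ 2 := by rw [mul_comm, pow_mul]
    rw [h5] at h4
    simp only [ne_eq]
    nlinarith
  have hinj : ((Finset.range (p ^ s) ×ˢ Finset.range (p ^ s)).filter
        (fun q => morphInf p ζ a (I * p ^ s + q.1) (J * p ^ s + q.2) ≠ z)).card ≤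
      ((Finset.range (p ^ (s + τ)) ×ˢ Finset.range (p ^ (s + τ))).filter
        (fun q => morphIter p ζ (s + τ) a q.1 q.2 ≠ z)).card := by
    apply Finset.card_le_card_of_injOn (fun q => (I' * p ^ s + q.1, J' * p ^ s + q.2))
    · rintro ⟨i, j⟩ hq
      simp only [Finset.coe_filter, Finset.mem_product, Finset.mem_range, Set.mem_ofPred_eq] at hq ⊢
      obtain ⟨⟨hi, hj⟩, hz⟩ := hq
      have hlt : ∀ I' i, I' < p ^ τ → i < p ^ s → I' * p ^ s + i < p ^ (s + τ) := by
        intro I' i h1 h2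
        calc I' * p ^ s + i < (I' + 1) * p ^ s := by rw [add_mul]; omega
          _ ≤ p ^ τ * p ^ s := Nat.mul_le_mul_right _ h1
          _ = p ^ (s + τ) := by rw [pow_add, mul_comm]
      refine ⟨⟨hlt _ _ hI' hi, hlt _ _ hJ' hj⟩, ?_⟩
      rw [← morphInf_eq hp hζa (s + τ) _ _ (hlt _ _ hI' hi) (hlt _ _ hJ' hj),
        morphInf_block hp hζa s I' J' i j hi hj, ← he, ← morphInf_block hp hζa s I J i j hi hj]
      exact hz
    · rintro ⟨i, j⟩ _ ⟨i', j'⟩ _ h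
      simp only [Prod.mk.injEq] at h ⊢
      omega
  calc _ ≤ (((Finset.range (p ^ (s + τ)) ×ˢ Finset.range (p ^ (s + τ))).filter
        (fun q => morphIter p ζ (s + τ) a q.1 q.2 ≠ z)).card : ℝ) := by exact_mod_cast hinj
    _ ≤ _ := htot
    _ = η * ((p : ℝ) ^ s) ^ 2 := by
      rw [hη', pow_add]; field_simp

end comb

lemma strip_bound (Nz : ℕ → ℕ → Prop) (m q B R M : ℕ) (hm : 0 < m) (hq : 0 < q) (hM : M ≤ m * q)
    (hB : ∀ I J : ℕ, ((Finset.range q ×ˢ Finset.range q).filter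
      (fun c => Nz (I * q + c.1) (J * q + c.2))).card ≤ B) (T : Finset ℕ) (hT : T ⊆ Finset.Icc 1 M) :
    ∑ κ ∈ T, ((Finset.range (R * (m * q))).filter
      (fun x => Nz (x / m) ((x + κ) / m))).card ≤ R * (2 * (m * m)) * B := by
  set U : Finset (ℕ × ℕ) := (Finset.range R ×ˢ (Finset.range 2 ×ˢ
    (Finset.range m ×ˢ Finset.range m))).biUnion fun w =>
      ((Finset.range q ×ˢ Finset.range q).filter
        (fun c => Nz (w.1 * q + c.1) ((w.1 + w.2.1) * q + c.2))).image
        fun c => ((w.1 * q + c.1) * m + w.2.2.1, ((w.1 + w.2.1) * q + c.2) * m + w.2.2.2) with hU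
  have hUc : U.card ≤ R * (2 * (m * m)) * B := by
    have := Finset.card_biUnion_le_card_mul (Finset.range R ×ˢ (Finset.range 2 ×ˢ
      (Finset.range m ×ˢ Finset.range m))) (fun w =>
      ((Finset.range q ×ˢ Finset.range q).filter
        (fun c => Nz (w.1 * q + c.1) ((w.1 + w.2.1) * q + c.2))).image
        fun c => ((w.1 * q + c.1) * m + w.2.2.1, ((w.1 + w.2.1) * q + c.2) * m + w.2.2.2)) B
        (fun w _ => Finset.card_image_le.trans (hB _ _))
    rw [Finset.card_product, Finset.card_product, Finset.card_product, Finset.card_range,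
      Finset.card_range, Finset.card_range] at this
    exact this
  refine le_trans ?_ hUc
  rw [← Finset.card_sigma]
  apply Finset.card_le_card_of_injOn (fun y => (y.2, y.2 + y.1))
  · rintro ⟨κ, x⟩ hy
    simp only [Finset.coe_sigma, Set.mem_sigma_iff, Finset.mem_coe, Finset.mem_filter,
      Finset.mem_range] at hy
    obtain ⟨hκ, hx, hz⟩ := hy
    have hκ' := Finset.mem_Icc.mp (hT hκ)
    simp only [Finset.mem_coe]
    rw [hU, Finset.mem_biUnion]
    have hb : 0 < m * q := Nat.mul_pos hm hq
    have hI : x / m / q = x / (m * q) := Nat.div_div_eq_div_mul _ _ _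
    have hJ : (x + κ) / m / q = (x + κ) / (m * q) := Nat.div_div_eq_div_mul _ _ _
    have hle : x / m / q ≤ (x + κ) / m / q := by
      rw [hI, hJ]; exact Nat.div_le_div_right (by omega)
    have hle2 : (x + κ) / m / q ≤ x / m / q + 1 := by
      rw [hI, hJ, ← Nat.add_div_right _ hb]; exact Nat.div_le_div_right (by omega)
    have hIR : x / m / q < R := by
      rw [hI, Nat.div_lt_iff_lt_mul hb]; exact hx
    have hsum : x / m / q + ((x + κ) / m / q - x / m / q) = (x + κ) / m / q := by omega
    refine ⟨(x / m / q, (x + κ) / m / q - x / m / q, x % m, (x + κ) % m), ?_, ?_⟩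
    · simp only [Finset.mem_product, Finset.mem_range]
      exact ⟨hIR, by omega, Nat.mod_lt _ hm, Nat.mod_lt _ hm⟩
    · rw [Finset.mem_image]
      refine ⟨(x / m % q, (x + κ) / m % q), ?_, ?_⟩
      · simp only [Finset.mem_filter, Finset.mem_product, Finset.mem_range]
        refine ⟨⟨Nat.mod_lt _ hq, Nat.mod_lt _ hq⟩, ?_⟩
        rw [hsum, Nat.div_add_mod', Nat.div_add_mod']
        exact hz
      · simp only
        rw [hsum, Nat.div_add_mod', Nat.div_add_mod', Nat.div_add_mod', Nat.div_add_mod']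
  · rintro ⟨κ, x⟩ _ ⟨κ', x'⟩ _ h
    simp only [Prod.mk.injEq] at h
    obtain ⟨h1, h2⟩ := h
    subst h1
    have : κ = κ' := by omega
    subst this
    rfl

/-- If the profile of the number wall of a quadratic irrational `Θ` over
a finite field of cardinality `p` is generated by an `[m,m]`-coding `ξ` of the fixed point
of a `[p,p]`-morphism `ζ` prolongable at `A`, with `ζ(0)` and `ξ(0)` all-zero, and if the
proportion of the letter `0` in `ζ^k(A)` tends to `1`, then `Θ` exhibits full generic
escape of mass with respect to `{t^k}`. -/
theorem generic_escape_criterion {K : Type} [Field K] [Fintype K]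
    {X : Type} [Fintype X] [DecidableEq X] (p m : ℕ)
    (hcard : Fintype.card K = p) (hm : 1 ≤ m)
    (Θ : LaurentSeries K) (hΘ : IsQuadIrr Θ)
    (z a : X) (ζ : X → ℕ → ℕ → X) (ξ : X → ℕ → ℕ → Bool)
    (hζa : ζ a 0 0 = a)
    (hζz : ∀ i j : ℕ, i < p → j < p → ζ z i j = z)
    (hξz : ∀ i j : ℕ, i < m → j < m → ξ z i j = false)
    (hprofile : ∀ m' n' : ℕ,
      wallEntry (coeffSeq Θ) m' (n' : ℤ) = 0 ↔
        ξ (morphInf p ζ a (m' / m) (n' / m)) (m' % m) (n' % m) = false)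
    (hN0 : Filter.Tendsto (fun k : ℕ =>
        (((Finset.range (p ^ k) ×ˢ Finset.range (p ^ k)).filter
            (fun q => morphIter p ζ k a q.1 q.2 = z)).card : ℝ) / (p : ℝ) ^ (2 * k))
      Filter.atTop (nhds 1)) :
    FullGenericEscape Θ := by
  have hp : 1 < p := by rw [← hcard]; exact Fintype.one_lt_card
  have hp0 : (0 : ℝ) < p := by exact_mod_cast (by omega : 0 < p)
  have hm0 : (0 : ℝ) < m := by exact_mod_cast hm
  intro ε hε
  refine ⟨fun _ => 1, fun n => ?_, tendsto_const_nhds⟩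
  set c : ℝ := ε / (2 * (n + 1)) with hc
  have hc0 : 0 < c := by positivity
  obtain ⟨Nz, hNz⟩ : ∃ Nz : ℕ → ℕ → Prop, ∀ i j, Nz i j ↔ morphInf p ζ a i j ≠ z :=
    ⟨fun i j => morphInf p ζ a i j ≠ z, fun _ _ => Iff.rfl⟩
  have hgrow : ∀ k : ℕ, ¬ (1 - ε < eMass Θ k n) → ∃ N0 : ℕ, ∀ N ≥ N0,
      c * N ≤ (((Finset.range N).filter (fun x => Nz (x / m) ((x + k) / m))).card : ℝ) := by
    intro k hk
    refine bad_growth hΘ k n ε hε (fun x => Nz (x / m) ((x + k) / m)) ?_ (not_lt.mp hk)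
    intro m' hw
    rw [hNz]
    intro hzz
    apply hw
    rw [hprofile, hzz]
    exact hξz _ _ (Nat.mod_lt _ hm) (Nat.mod_lt _ hm)
  rw [HasDensity, Metric.tendsto_atTop]
  intro δ hδ
  set η : ℝ := δ * c / (4 * m * p) with hη
  have hη0 : 0 < η := by positivity
  obtain ⟨S, hS⟩ := block_bound hp hζa z (by convert hN0) η hη0
  refine ⟨max 1 (p ^ S), fun M hM => ?_⟩
  have hM1 : 1 ≤ M := le_trans (le_max_left _ _) hM
  have hMS : p ^ S ≤ M := le_trans (le_max_right _ _) hM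
  have hMpos : (0 : ℝ) < M := by exact_mod_cast hM1
  set s := Nat.log p M + 1 with hs
  have hsS : S ≤ s := by
    have : S ≤ Nat.log p M := (Nat.le_log_iff_pow_le hp (by omega)).mpr hMS
    omega
  set q := p ^ s with hq
  have hqM : M < q := Nat.lt_pow_succ_log_self hp M
  have hqM' : q ≤ p * M := by
    rw [hq, hs, pow_succ, mul_comm]
    exact Nat.mul_le_mul_left _ (Nat.pow_log_le_self p (by omega))
  have hq0 : 0 < q := by omega
  set T := (Finset.Icc 1 M).filter (fun k => ¬ (1 - ε < eMass Θ k n)) with hT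
  have hTbound : (T.card : ℝ) * (2 * c) ≤ δ * c * M := by
    choose! N0 hN0' using hgrow
    set R := ∑ k ∈ T, N0 k + 1 with hR
    have hcardle : ∀ I J : ℕ, ((Finset.range q ×ˢ Finset.range q).filter
        (fun c => Nz (I * q + c.1) (J * q + c.2))).card ≤ ⌊η * ((p : ℝ) ^ s) ^ 2⌋₊ := by
      intro I J
      apply Nat.le_floor
      refine le_trans (le_of_eq ?_) (hS s hsS I J)
      congr 2
      ext c
      simp only [Finset.mem_filter, hNz]
      exact Iff.rfl
    have hblock := strip_bound Nz m q (⌊η * ((p : ℝ) ^ s) ^ 2⌋₊) R M hm hq0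
      (by nlinarith) hcardle T (Finset.filter_subset _ _)
    have hlow : ∀ k ∈ T, c * ((R * (m * q) : ℕ) : ℝ) ≤
        (((Finset.range (R * (m * q))).filter (fun x => Nz (x / m) ((x + k) / m))).card : ℝ) := by
      intro k hk
      apply hN0' k (Finset.mem_filter.mp hk).2
      have h1 : N0 k ≤ R := by
        have := Finset.single_le_sum (f := N0) (fun i _ => Nat.zero_le _) hk
        omega
      have h2 : 1 ≤ m * q := Nat.mul_pos hm hq0
      nlinarith
    have h1 := Finset.sum_le_sum hlow
    rw [Finset.sum_const, nsmul_eq_mul, ← Nat.cast_sum] at h1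
    have h2 : ((∑ κ ∈ T, ((Finset.range (R * (m * q))).filter
      (fun x => Nz (x / m) ((x + κ) / m))).card : ℕ) : ℝ) ≤
        ((R * (2 * (m * m)) * ⌊η * ((p : ℝ) ^ s) ^ 2⌋₊ : ℕ) : ℝ) := by exact_mod_cast hblock
    have h3 : ((⌊η * ((p : ℝ) ^ s) ^ 2⌋₊ : ℕ) : ℝ) ≤ η * ((p : ℝ) ^ s) ^ 2 :=
      Nat.floor_le (by positivity)
    have h4 := h1.trans h2
    push_cast at h4
    have hqr : (q : ℝ) = (p : ℝ) ^ s := by rw [hq]; push_cast; rfl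
    rw [← hqr] at h3 h4
    have hRpos : (0 : ℝ) < R := by exact_mod_cast Nat.succ_pos _
    have hqpos : (0 : ℝ) < q := by exact_mod_cast hq0
    have h5 : (T.card : ℝ) * (c * (R * (m * q))) ≤ R * (2 * (m * m)) * (η * q ^ 2) :=
      h4.trans (mul_le_mul_of_nonneg_left h3 (by positivity))
    have h6 : (R * m * q : ℝ) * (T.card * c) ≤ (R * m * q : ℝ) * (2 * m * η * q) := by
      linarith
    have h7 := le_of_mul_le_mul_left h6 (by positivity)
    have h8 : (q : ℝ) ≤ p * M := by exact_mod_cast hqM'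
    have h9 : 2 * m * η * q ≤ 2 * m * η * (p * M) := mul_le_mul_of_nonneg_left h8 (by positivity)
    have h10 : 2 * m * η * (p * M) = δ * c * M / 2 := by
      rw [hη]; field_simp; ring
    linarith
  have hT2 : (T.card : ℝ) ≤ δ / 2 * M := by
    have : c * (T.card : ℝ) ≤ c * (δ / 2 * M) := by linarith
    exact le_of_mul_le_mul_left this hc0
  have hsplit := Finset.card_filter_add_card_filter_not (s := Finset.Icc 1 M)
    (fun k => 1 - ε < eMass Θ k n)
  rw [Nat.card_Icc, Nat.add_sub_cancel] at hsplit
  have hsplit' := congrArg (Nat.cast : ℕ → ℝ) hsplit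
  push_cast at hsplit'
  rw [Real.dist_eq]
  simp only [Set.mem_ofPred_eq]
  have e1 : (((Finset.Icc 1 M).filter fun k => 1 - ε < eMass Θ k n).card : ℝ) / M - 1 =
      - ((T.card : ℝ) / M) := by
    rw [hT, eq_sub_of_add_eq hsplit']
    field_simp
    ring
  rw [e1, abs_neg, abs_of_nonneg (by positivity), div_lt_iff₀ hMpos]
  nlinarith [mul_pos hδ hMpos]

end EscapeOfMass
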